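/- arXiv:1311.4137 — 3 statements merged into one kernel-verified Lean document; each statement's English description precedes it below -/
import Mathlib

section
/- Let κ > 0, τ > 0, t ∈ ℝ, and let ρ, ρ⊥ ∈ ℝ³ with ‖ρ‖ = ‖ρ⊥‖ = 1 and ⟨ρ, ρ⊥⟩ = 0. Then the function U : ℝ³ → ℂ defined by U(x) := exp(τ(⟨x, ρ⟩ − t) + i·√(τ² + κ²)·⟨x, ρ⊥⟩) satisfies the Helmholtz equation ΔU(x) + κ²·U(x) = 0 at every x ∈ ℝ³. -/
open scoped RealInnerProductSpace
noncomputable section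

/-- `ℝ³` as a Euclidean space. -/
abbrev V3 := EuclideanSpace ℝ (Fin 3)

/-- Partial derivative in the `j`-th coordinate direction. -/
def pd (j : Fin 3) (f : V3 → ℂ) (x : V3) : ℂ :=
  fderiv ℝ f x (EuclideanSpace.single j 1)

/-- Laplacian of a scalar function. -/
def lap (f : V3 → ℂ) (x : V3) : ℂ := ∑ j, pd j (pd j f) x

/-- Divergence of a vector field. -/
def vdiv (u : V3 → Fin 3 → ℂ) (x : V3) : ℂ := ∑ j, pd j (fun y => u y j) x

/-- Componentwise Laplacian of a vector field. -/
def vlap (u : V3 → Fin 3 → ℂ) (x : V3) (i : Fin 3) : ℂ := lap (fun y => u y i) x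

/-- Curl of a vector field. -/
def vcurl (u : V3 → Fin 3 → ℂ) : V3 → Fin 3 → ℂ := fun x =>
  ![pd 1 (fun y => u y 2) x - pd 2 (fun y => u y 1) x,
    pd 2 (fun y => u y 0) x - pd 0 (fun y => u y 2) x,
    pd 0 (fun y => u y 1) x - pd 1 (fun y => u y 0) x]

/-- Partial derivatives of a multiple of the exponential of an affine function. -/
lemma pd_const_mul_cexp (L : V3 →L[ℝ] ℂ) (a c : ℂ) (j : Fin 3) :
    pd j (fun x => a * Complex.exp (L x + c)) =
      fun x => a * L (EuclideanSpace.single j 1) * Complex.exp (L x + c) := by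
  funext x
  have h : HasFDerivAt (fun x => a * Complex.exp (L x + c))
      (a • (Complex.exp (L x + c) • L)) x :=
    ((L.hasFDerivAt.add_const c).cexp).const_mul a
  rw [pd, h.fderiv]
  simp only [FunLike.coe_smul, Pi.smul_apply, smul_eq_mul]
  ring

/-- The Laplacian of the exponential of an affine function. -/
lemma lap_cexp (L : V3 →L[ℝ] ℂ) (c : ℂ) (x : V3) :
    lap (fun x => Complex.exp (L x + c)) x =
      (∑ j, L (EuclideanSpace.single j 1) ^ 2) * Complex.exp (L x + c) := by
  have h (j : Fin 3) := pd_const_mul_cexp L 1 c j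
  simp only [one_mul] at h
  simp only [lap, h, pd_const_mul_cexp, Finset.sum_mul, sq]

/-- The sum of the squares of the coordinates of `a ρ + b σ` for orthonormal `ρ`, `σ`. -/
lemma sum_sq_orthonormal_combination {ρ σ : V3} (hρ : ‖ρ‖ = 1) (hσ : ‖σ‖ = 1)
    (h : ⟪ρ, σ⟫ = 0) (a b : ℂ) :
    ∑ j, (a * (ρ j : ℂ) + b * (σ j : ℂ)) ^ 2 = a ^ 2 + b ^ 2 := by
  have hρ' : ((∑ j, ρ j ^ 2 : ℝ) : ℂ) = 1 := by
    rw [← EuclideanSpace.real_norm_sq_eq, hρ]; simp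
  have hσ' : ((∑ j, σ j ^ 2 : ℝ) : ℂ) = 1 := by
    rw [← EuclideanSpace.real_norm_sq_eq, hσ]; simp
  have h' : ((⟪ρ, σ⟫ : ℝ) : ℂ) = 0 := by rw [h]; simp
  simp only [PiLp.inner_apply, Fin.sum_univ_three, RCLike.inner_apply, conj_trivial] at h' hρ' hσ' ⊢
  push_cast at h' hρ' hσ'
  linear_combination a ^ 2 * hρ' + b ^ 2 * hσ' + 2 * a * b * h'

theorem stmt_9 (κ τ t : ℝ) (hκ : 0 < κ) (hτ : 0 < τ)
    (ρ ρperp : V3) (hρ : ‖ρ‖ = 1) (hρperp : ‖ρperp‖ = 1) (horth : ⟪ρ, ρperp⟫ = 0)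
    (U : V3 → ℂ)
    (hU : ∀ x, U x
      = Complex.exp (((τ * (⟪x, ρ⟫ - t) : ℝ) : ℂ)
          + Complex.I * ((Real.sqrt (τ ^ 2 + κ ^ 2) : ℝ) : ℂ) * ((⟪x, ρperp⟫ : ℝ) : ℂ))) :
    ∀ x, lap U x + ((κ ^ 2 : ℝ) : ℂ) * U x = 0 := by
  intro x
  set s : ℝ := Real.sqrt (τ ^ 2 + κ ^ 2) with hs
  have hs2 : (s : ℂ) ^ 2 = (τ : ℂ) ^ 2 + (κ : ℂ) ^ 2 := by
    exact_mod_cast Real.sq_sqrt (by positivity : 0 ≤ τ ^ 2 + κ ^ 2)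
  let L : V3 →L[ℝ] ℂ := (τ : ℂ) • Complex.ofRealCLM.comp (innerSL ℝ ρ) +
    (Complex.I * (s : ℂ)) • Complex.ofRealCLM.comp (innerSL ℝ ρperp)
  have hL (y : V3) : L y =
      (τ : ℂ) * ((⟪y, ρ⟫ : ℝ) : ℂ) + Complex.I * (s : ℂ) * ((⟪y, ρperp⟫ : ℝ) : ℂ) := by
    simp [L, real_inner_comm]
  have hUL : U = fun y => Complex.exp (L y + -((τ : ℂ) * (t : ℂ))) := by
    funext y
    rw [hU, hL]
    push_cast
    ring_nf
  have hsum : ∑ j, L (EuclideanSpace.single j 1) ^ 2 = -(κ : ℂ) ^ 2 := by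
    have hc (j : Fin 3) : L (EuclideanSpace.single j 1) =
        (τ : ℂ) * (ρ j : ℂ) + Complex.I * (s : ℂ) * (ρperp j : ℂ) := by
      simp [hL, EuclideanSpace.inner_single_left]
    simp only [hc]
    rw [sum_sq_orthonormal_combination hρ hρperp horth, mul_pow, Complex.I_sq, hs2]
    ring
  rw [hUL, lap_cexp, hsum]
  push_cast
  ring
end
end

section
/- Let μ₀ > 0, λ₀ ∈ ℝ with λ₀ + 2μ₀ > 0 and κ > 0. Suppose w : ℝ³ → ℂ³ is twice continuously differentiable and g : ℝ³ → ℂ is three times continuously differentiable, and that they satisfy the system Δw + (κ²/μ₀)·w = 0 and Δg + ((λ₀ + μ₀)/(λ₀ + 2μ₀))·√μ₀·(div w) + (κ²/(λ₀ + 2μ₀))·g = 0 on ℝ³. Then u := μ₀^{-1/2}·w + μ₀^{-1}·∇g satisfies the Navier equation μ₀·Δu + (λ₀ + μ₀)·∇(div u) + κ²·u = 0 on ℝ³. -/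
open scoped RealInnerProductSpace
noncomputable section

theorem ContDiff.pd {m n : WithTop ℕ∞} {f : V3 → ℂ} (hf : ContDiff ℝ n f) (hmn : m + 1 ≤ n)
    (j : Fin 3) : ContDiff ℝ m (_root_.pd j f) :=
  (hf.fderiv_right hmn).clm_apply contDiff_const

theorem pd_const_mul {f : V3 → ℂ} (hf : ContDiff ℝ 1 f) (c : ℂ) (j : Fin 3) :
    pd j (fun y => c * f y) = fun y => c * pd j f y := by
  funext x
  simp [pd, fderiv_const_mul (hf.differentiable one_ne_zero x)]

theorem pd_add {f g : V3 → ℂ} (hf : ContDiff ℝ 1 f) (hg : ContDiff ℝ 1 g) (j : Fin 3) :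
    pd j (fun y => f y + g y) = fun y => pd j f y + pd j g y := by
  funext x
  simp [pd, fderiv_fun_add (hf.differentiable one_ne_zero x) (hg.differentiable one_ne_zero x)]

theorem pd_linear_comb {f g : V3 → ℂ} (hf : ContDiff ℝ 1 f) (hg : ContDiff ℝ 1 g) (a b : ℂ)
    (j : Fin 3) :
    pd j (fun y => a * f y + b * g y) = fun y => a * pd j f y + b * pd j g y := by
  rw [pd_add (contDiff_const.mul hf) (contDiff_const.mul hg), pd_const_mul hf, pd_const_mul hg]

theorem pd_sum {f : Fin 3 → V3 → ℂ} (hf : ∀ k, ContDiff ℝ 1 (f k)) (j : Fin 3) :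
    pd j (fun y => ∑ k, f k y) = fun y => ∑ k, pd j (f k) y := by
  funext x
  simp [pd, fderiv_fun_sum fun k _ => (hf k).differentiable one_ne_zero x]

theorem pd_comm {f : V3 → ℂ} (hf : ContDiff ℝ 2 f) (i j : Fin 3) :
    pd i (pd j f) = pd j (pd i f) := by
  have hd : Differentiable ℝ (fderiv ℝ f) :=
    (hf.fderiv_right (m := 1) (by norm_num)).differentiable one_ne_zero
  have key : ∀ (k l : Fin 3) (x : V3), pd k (pd l f) x =
      fderiv ℝ (fderiv ℝ f) x (EuclideanSpace.single k 1) (EuclideanSpace.single l 1) := by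
    intro k l x
    change fderiv ℝ (fun y => fderiv ℝ f y (EuclideanSpace.single l 1)) x _ = _
    rw [fderiv_clm_apply (hd x) (differentiableAt_const _)]
    simp
  funext x
  rw [key, key]
  exact (hf.contDiffAt.isSymmSndFDerivAt (by simp)).eq _ _

theorem lap_linear_comb {f g : V3 → ℂ} (hf : ContDiff ℝ 2 f) (hg : ContDiff ℝ 2 g) (a b : ℂ)
    (x : V3) : lap (fun y => a * f y + b * g y) x = a * lap f x + b * lap g x := by
  simp only [lap, Finset.mul_sum, ← Finset.sum_add_distrib]
  refine Finset.sum_congr rfl fun j _ => ?_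
  rw [pd_linear_comb (hf.of_le (by norm_num)) (hg.of_le (by norm_num)),
    pd_linear_comb (hf.pd (by norm_num) j) (hg.pd (by norm_num) j)]

theorem ContDiff.lap {f : V3 → ℂ} (hf : ContDiff ℝ 3 f) : ContDiff ℝ 1 (_root_.lap f) :=
  ContDiff.sum fun j _ => (hf.pd (m := 2) (by norm_num) j).pd (by norm_num) j

theorem lap_pd {f : V3 → ℂ} (hf : ContDiff ℝ 3 f) (i : Fin 3) : lap (pd i f) = pd i (lap f) := by
  have hd : ∀ j, ContDiff ℝ 2 (pd j f) := fun j => hf.pd (by norm_num) j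
  change _ = pd i (fun y => ∑ j, pd j (pd j f) y)
  rw [pd_sum fun j => (hd j).pd (by norm_num) j]
  funext x
  refine Finset.sum_congr rfl fun j _ => ?_
  rw [pd_comm (hf.of_le (by norm_num)) j i, pd_comm (hd j) j i]

theorem ContDiff.vdiv {w : V3 → Fin 3 → ℂ} (hw : ContDiff ℝ 2 w) :
    ContDiff ℝ 1 (_root_.vdiv w) :=
  ContDiff.sum fun j _ => (contDiff_pi.mp hw j).pd (by norm_num) j

/-- The divergence of `a w + b ∇g` is `a div w + b Δg`. -/
theorem vdiv_linear_comb_grad {w : V3 → Fin 3 → ℂ} {g : V3 → ℂ} (hw : ContDiff ℝ 1 w)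
    (hg : ContDiff ℝ 2 g) (a b : ℂ) :
    vdiv (fun y i => a * w y i + b * pd i g y) = fun x => a * vdiv w x + b * lap g x := by
  funext x
  simp only [vdiv, lap, Finset.mul_sum, ← Finset.sum_add_distrib]
  refine Finset.sum_congr rfl fun j _ => ?_
  rw [pd_linear_comb (contDiff_pi.mp hw j) (hg.pd (by norm_num) j)]

theorem stmt_15 (μ₀ lam0 κ : ℝ) (hμ : 0 < μ₀) (hlam : 0 < lam0 + 2 * μ₀) (hκ : 0 < κ)
    (w : V3 → Fin 3 → ℂ) (g : V3 → ℂ)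
    (hw : ContDiff ℝ 2 w) (hg : ContDiff ℝ 3 g)
    (hw_eq : ∀ x i, vlap w x i + ((κ ^ 2 / μ₀ : ℝ) : ℂ) * w x i = 0)
    (hg_eq : ∀ x, lap g x
      + (((lam0 + μ₀) / (lam0 + 2 * μ₀) * Real.sqrt μ₀ : ℝ) : ℂ) * vdiv w x
      + ((κ ^ 2 / (lam0 + 2 * μ₀) : ℝ) : ℂ) * g x = 0)
    (u : V3 → Fin 3 → ℂ)
    (hu : ∀ x i, u x i
      = (((Real.sqrt μ₀)⁻¹ : ℝ) : ℂ) * w x i + ((μ₀⁻¹ : ℝ) : ℂ) * pd i g x) :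
    ∀ x i, (μ₀ : ℂ) * vlap u x i + ((lam0 + μ₀ : ℝ) : ℂ) * pd i (vdiv u) x
      + ((κ ^ 2 : ℝ) : ℂ) * u x i = 0 := by
  intro x i
  obtain rfl : u = fun y i => (((Real.sqrt μ₀)⁻¹ : ℝ) : ℂ) * w y i
      + ((μ₀⁻¹ : ℝ) : ℂ) * pd i g y := by
    funext y k
    exact hu y k
  have hlapg : lap g = fun y =>
      (-(((lam0 + μ₀) / (lam0 + 2 * μ₀) * Real.sqrt μ₀ : ℝ) : ℂ)) * vdiv w y
      + (-((κ ^ 2 / (lam0 + 2 * μ₀) : ℝ) : ℂ)) * g y := by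
    funext y
    linear_combination hg_eq y
  have hgrad : pd i (lap g) x =
      (-(((lam0 + μ₀) / (lam0 + 2 * μ₀) * Real.sqrt μ₀ : ℝ) : ℂ)) * pd i (vdiv w) x
      + (-((κ ^ 2 / (lam0 + 2 * μ₀) : ℝ) : ℂ)) * pd i g x := by
    rw [hlapg, pd_linear_comb hw.vdiv (hg.of_le (by norm_num))]
  have hlapw : lap (fun y => w y i) x = -((κ ^ 2 / μ₀ : ℝ) : ℂ) * w x i := by
    have h := hw_eq x i
    rw [vlap] at h
    linear_combination h
  rw [vdiv_linear_comb_grad (hw.of_le (by norm_num)) (hg.of_le (by norm_num)),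
    pd_linear_comb hw.vdiv hg.lap]
  simp only [vlap]
  rw [lap_linear_comb (contDiff_pi.mp hw i) (hg.pd (by norm_num) i), lap_pd hg, hgrad, hlapw]
  have hs : ((Real.sqrt μ₀ : ℝ) : ℂ) ^ 2 = (μ₀ : ℂ) := by
    exact_mod_cast Real.sq_sqrt hμ.le
  have hs0 : ((Real.sqrt μ₀ : ℝ) : ℂ) ≠ 0 := by
    exact_mod_cast (Real.sqrt_pos.mpr hμ).ne'
  have hl0 : (lam0 : ℂ) + 2 * (μ₀ : ℂ) ≠ 0 := by
    exact_mod_cast hlam.ne'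
  push_cast
  rw [← hs] at hl0 ⊢
  generalize hD : (lam0 : ℂ) + 2 * ((Real.sqrt μ₀ : ℝ) : ℂ) ^ 2 = D at hl0 ⊢
  rw [eq_sub_of_add_eq hD]
  field_simp
  ring
end
end

section
/- Let x₀ ∈ ℝ³ and ω₀ ∈ ℝ³ with ‖ω₀‖ = 1. Define φ(x) := log‖x − x₀‖ and ψ(x) := π/2 − arctan(⟨ω₀, x − x₀⟩ / √(‖x − x₀‖² − ⟨ω₀, x − x₀⟩²)). Then at every point x ∈ ℝ³ with ‖x − x₀‖² > ⟨ω₀, x − x₀⟩² (i.e. x − x₀ is not a scalar multiple of ω₀), both φ and ψ are differentiable and the eikonal equations hold: ‖∇ψ(x)‖² = ‖∇φ(x)‖² and ⟨∇φ(x), ∇ψ(x)⟩ = 0. -/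
open scoped RealInnerProductSpace

section Gradients

variable {F : Type*} [NormedAddCommGroup F] [InnerProductSpace ℝ F] [CompleteSpace F]

theorem hasGradientAt_log_norm_sub (x₀ : F) {x : F} (hx : x - x₀ ≠ 0) :
    HasGradientAt (fun x => Real.log ‖x - x₀‖) ((‖x - x₀‖ ^ 2)⁻¹ • (x - x₀)) x := by
  have hr : ‖x - x₀‖ ^ 2 ≠ 0 := by simpa using hx
  have h := ((((hasFDerivAt_id x).sub_const x₀).norm_sq).log hr).const_mul (1 / 2 : ℝ)
  rw [hasGradientAt_iff_hasFDerivAt]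
  refine (h.congr_of_eventuallyEq (.of_forall fun z => ?_)).congr_fderiv ?_
  · simp [Real.log_pow]
  · ext v
    simp
    ring

theorem hasGradientAt_arctan_inner_div_sqrt (x₀ ω₀ : F) {x : F}
    (hx : ⟪ω₀, x - x₀⟫ ^ 2 < ‖x - x₀‖ ^ 2) :
    HasGradientAt
      (fun x => Real.arctan (⟪ω₀, x - x₀⟫ / Real.sqrt (‖x - x₀‖ ^ 2 - ⟪ω₀, x - x₀⟫ ^ 2)))
      ((Real.sqrt (‖x - x₀‖ ^ 2 - ⟪ω₀, x - x₀⟫ ^ 2))⁻¹ •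
        (ω₀ - (⟪ω₀, x - x₀⟫ / ‖x - x₀‖ ^ 2) • (x - x₀))) x := by
  have hpos : 0 < ‖x - x₀‖ ^ 2 - ⟪ω₀, x - x₀⟫ ^ 2 := sub_pos.2 hx
  have hr : 0 < ‖x - x₀‖ ^ 2 := (sq_nonneg _).trans_lt hx
  have hs : 0 < Real.sqrt (‖x - x₀‖ ^ 2 - ⟪ω₀, x - x₀⟫ ^ 2) := Real.sqrt_pos.2 hpos
  have hs2 := Real.sq_sqrt hpos.le
  have hy := (hasFDerivAt_id (𝕜 := ℝ) x).sub_const x₀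
  have ht : HasFDerivAt (fun x => ⟪ω₀, x - x₀⟫) (innerSL ℝ ω₀) x :=
    (innerSL ℝ ω₀).hasFDerivAt.comp x hy
  have h := (ht.fun_mul ((hasDerivAt_inv hs.ne').comp_hasFDerivAt x
    ((hy.norm_sq.fun_sub (ht.pow 2)).sqrt hpos.ne'))).arctan
  rw [hasGradientAt_iff_hasFDerivAt]
  refine h.congr_fderiv ?_
  ext v
  clear h ht hy hx hpos
  simp only [id_eq, Function.comp_apply,
    ContinuousLinearMap.comp_id, smul_apply, sub_apply, add_apply,
    InnerProductSpace.toDual_apply_apply, innerSL_apply_apply, smul_eq_mul, nsmul_eq_mul]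
  generalize x - x₀ = y at *
  rw [real_inner_smul_left, inner_sub_left, real_inner_smul_left]
  generalize ⟪y, v⟫ = b
  generalize ⟪ω₀, v⟫ = a
  generalize √(‖y‖ ^ 2 - ⟪ω₀, y⟫ ^ 2) = s at *
  generalize ⟪ω₀, y⟫ = t at *
  have hsum : s ^ 2 + t ^ 2 = ‖y‖ ^ 2 := by linarith
  have hquot : 1 + (t * s⁻¹) ^ 2 = ‖y‖ ^ 2 / s ^ 2 := by
    rw [← hsum]
    field_simp
  rw [hquot, ← hsum]
  rw [← hsum] at hr
  push_cast
  field_simp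
  ring

end Gradients

theorem stmt_16 (x₀ ω₀ : EuclideanSpace ℝ (Fin 3)) (hω : ‖ω₀‖ = 1)
    (φ ψ : EuclideanSpace ℝ (Fin 3) → ℝ)
    (hφ : ∀ x, φ x = Real.log ‖x - x₀‖)
    (hψ : ∀ x, ψ x = Real.pi / 2
      - Real.arctan (⟪ω₀, x - x₀⟫ / Real.sqrt (‖x - x₀‖ ^ 2 - ⟪ω₀, x - x₀⟫ ^ 2))) :
    ∀ x : EuclideanSpace ℝ (Fin 3), ⟪ω₀, x - x₀⟫ ^ 2 < ‖x - x₀‖ ^ 2 →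
      DifferentiableAt ℝ φ x ∧ DifferentiableAt ℝ ψ x ∧
      ‖gradient ψ x‖ ^ 2 = ‖gradient φ x‖ ^ 2 ∧ ⟪gradient φ x, gradient ψ x⟫ = 0 := by
  intro x hx
  have hpos : 0 < ‖x - x₀‖ ^ 2 - ⟪ω₀, x - x₀⟫ ^ 2 := sub_pos.2 hx
  have hr : 0 < ‖x - x₀‖ ^ 2 := (sq_nonneg _).trans_lt hx
  have hs2 := Real.sq_sqrt hpos.le
  have hs : 0 < Real.sqrt (‖x - x₀‖ ^ 2 - ⟪ω₀, x - x₀⟫ ^ 2) := Real.sqrt_pos.2 hpos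
  have hy : x - x₀ ≠ 0 := fun h => by simp [h] at hr
  have hr0 : ‖x - x₀‖ ≠ 0 := norm_ne_zero_iff.2 hy
  have gφ := hasGradientAt_log_norm_sub x₀ hy
  rw [← funext hφ] at gφ
  have gψ := (hasGradientAt_arctan_inner_div_sqrt x₀ ω₀ hx).hasFDerivAt.const_sub (Real.pi / 2)
  rw [← funext hψ, ← map_neg, ← hasGradientAt_iff_hasFDerivAt] at gψ
  refine ⟨gφ.differentiableAt, gψ.differentiableAt, ?_, ?_⟩ <;> rw [gφ.gradient, gψ.gradient] <;>
    clear gφ gψ hx <;> generalize x - x₀ = y at *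
  · rw [norm_neg, norm_smul, norm_smul, mul_pow, mul_pow,
      norm_sub_sq_real, norm_smul, inner_smul_right, hω]
    simp only [norm_inv, Real.norm_eq_abs, inv_pow, sq_abs, mul_pow, abs_div, div_pow, hs2]
    have hne := hpos.ne'
    field_simp
    ring
  · rw [inner_neg_right, inner_smul_left, inner_smul_right,
      inner_sub_right, inner_smul_right, real_inner_self_eq_norm_sq, real_inner_comm,
      div_mul_cancel₀ _ hr.ne']
    simp
end
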